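/- Let n ≥ 2 and let (D_j, ρ_j), for j in a finite index set J, be a family of partial assignments each of which forces f_n = 0, such that every x in the restricted family with f_n(x) = 0 extends (D_j, ρ_j) for at least one j ∈ J. Then |J| ≥ (3/2)^{n−2}. -/

import Mathlib

/-- `P_n`: unordered pairs of distinct elements of the `n`-element vertex set. -/
abbrev EdgeIx (n : ℕ) := {p : Sym2 (Fin n) // ¬ p.IsDiag}

/-- Read an assignment `x : P_n → {0,1}` at an arbitrary unordered pair. -/
def xe {n : ℕ} (x : EdgeIx n → Bool) (p : Sym2 (Fin n)) : Bool :=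
  if h : p.IsDiag then false else x ⟨p, h⟩

/-- Vertex `1`. -/
def vone (n : ℕ) (hn : 2 ≤ n) : Fin n := ⟨0, by omega⟩

/-- Vertex `n`. -/
def vlast (n : ℕ) (hn : 2 ≤ n) : Fin n := ⟨n - 1, by omega⟩

/-- The 2-reachability function `f_n`. -/
def fReach (n : ℕ) (hn : 2 ≤ n) (x : EdgeIx n → Bool) : Bool :=
  xe x s(vone n hn, vlast n hn) ||
    decide (∃ v : Fin n, v ≠ vone n hn ∧ v ≠ vlast n hn ∧
      xe x s(vone n hn, v) = true ∧ xe x s(v, vlast n hn) = true)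

/-- `E'_n`: the pairs containing vertex `1` or vertex `n`. -/
def Estar (n : ℕ) (hn : 2 ≤ n) : Finset (EdgeIx n) :=
  Finset.univ.filter (fun e => vone n hn ∈ e.1 ∨ vlast n hn ∈ e.1)

/-- The graph joining each interior vertex `v` to vertex `1` if `v ∈ S`, and to vertex `n`
otherwise. -/
def splitGraph (n : ℕ) (hn : 2 ≤ n) (S : Finset (Fin n)) (e : EdgeIx n) : Bool :=
  decide (∃ v : Fin n, v ≠ vone n hn ∧ v ≠ vlast n hn ∧
    ((e.1 = s(vone n hn, v) ∧ v ∈ S) ∨ (e.1 = s(v, vlast n hn) ∧ v ∉ S)))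

theorem vone_ne_vlast (n : ℕ) (hn : 2 ≤ n) : vone n hn ≠ vlast n hn := by
  simp only [vone, vlast, ne_eq, Fin.mk.injEq]
  omega

theorem xe_of_ne {n : ℕ} (x : EdgeIx n → Bool) {a b : Fin n} (h : a ≠ b) :
    xe x s(a, b) = x ⟨s(a, b), by simpa using h⟩ := by
  simp [xe, h]

theorem xe_splitGraph_vone {n : ℕ} (hn : 2 ≤ n) (S : Finset (Fin n)) {v : Fin n}
    (h1 : v ≠ vone n hn) (h2 : v ≠ vlast n hn) :
    xe (splitGraph n hn S) s(vone n hn, v) = decide (v ∈ S) := by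
  have h0 := vone_ne_vlast n hn
  rw [xe_of_ne _ h1.symm, splitGraph]
  congr 1
  simp only [Sym2.eq_iff, eq_iff_iff]
  grind

theorem xe_splitGraph_vlast {n : ℕ} (hn : 2 ≤ n) (S : Finset (Fin n)) {v : Fin n}
    (h1 : v ≠ vone n hn) (h2 : v ≠ vlast n hn) :
    xe (splitGraph n hn S) s(v, vlast n hn) = decide (v ∉ S) := by
  have h0 := vone_ne_vlast n hn
  rw [xe_of_ne _ h2, splitGraph]
  congr 1
  simp only [Sym2.eq_iff, eq_iff_iff]
  grind

theorem fReach_splitGraph {n : ℕ} (hn : 2 ≤ n) (S : Finset (Fin n)) :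
    fReach n hn (splitGraph n hn S) = false := by
  have h0 := vone_ne_vlast n hn
  simp only [fReach, Bool.or_eq_false_iff, decide_eq_false_iff_not]
  constructor
  · rw [xe_of_ne _ h0, splitGraph]
    simp only [Sym2.eq_iff, decide_eq_false_iff_not]
    grind
  · rintro ⟨v, h1, h2, h3, h4⟩
    rw [xe_splitGraph_vone hn S h1 h2] at h3
    rw [xe_splitGraph_vlast hn S h1 h2] at h4
    simp_all

theorem splitGraph_eq_false_of_notMem_Estar {n : ℕ} (hn : 2 ≤ n) (S : Finset (Fin n))
    {e : EdgeIx n} (he : e ∉ Estar n hn) : splitGraph n hn S e = false := by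
  simp only [splitGraph, decide_eq_false_iff_not]
  rintro ⟨v, -, -, ⟨h, -⟩ | ⟨h, -⟩⟩ <;> simp [Estar, h] at he

/-- If a zero-forcing partial assignment is extended by the split graphs of both `S` and `T`,
then every interior vertex of `S` lies in `T`. -/
theorem mem_of_forces_of_extends {n : ℕ} (hn : 2 ≤ n) {D : Finset (EdgeIx n)}
    {ρ : EdgeIx n → Bool}
    (hforce : ∀ x : EdgeIx n → Bool, (∀ e ∈ D, x e = ρ e) → fReach n hn x = false)
    {S T : Finset (Fin n)} (hS : ∀ e ∈ D, splitGraph n hn S e = ρ e)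
    (hT : ∀ e ∈ D, splitGraph n hn T e = ρ e) {v : Fin n}
    (h1 : v ≠ vone n hn) (h2 : v ≠ vlast n hn) (hv : v ∈ S) : v ∈ T := by
  by_contra hvT
  have h := hforce (fun e => splitGraph n hn S e || splitGraph n hn T e)
    (fun e he => by simp [hS e he, hT e he])
  simp only [fReach, Bool.or_eq_false_iff, decide_eq_false_iff_not] at h
  have hS1 := xe_splitGraph_vone hn S h1 h2
  have hT2 := xe_splitGraph_vlast hn T h1 h2
  rw [xe_of_ne _ h1.symm] at hS1
  rw [xe_of_ne _ h2] at hT2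
  refine h.2 ⟨v, h1, h2, ?_, ?_⟩
  · rw [xe_of_ne _ h1.symm, hS1]
    simp [hv]
  · rw [xe_of_ne _ h2, hT2]
    simp [hvT]

/-- Any family of zero-forcing partial assignments covering all members of the restricted
family on which `f_n = 0` must have at least `(3/2) ^ (n−2)` members. -/
theorem covering_family_large (n : ℕ) (hn : 2 ≤ n) {J : Type*} [Fintype J]
    (D : J → Finset (EdgeIx n)) (ρ : J → EdgeIx n → Bool)
    (hforce : ∀ j : J, ∀ x : EdgeIx n → Bool,
      (∀ e ∈ D j, x e = ρ j e) → fReach n hn x = false)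
    (hcover : ∀ x : EdgeIx n → Bool,
      (∀ e : EdgeIx n, e ∉ Estar n hn → x e = false) → fReach n hn x = false →
        ∃ j : J, ∀ e ∈ D j, x e = ρ j e) :
    ((3 : ℝ) / 2) ^ (n - 2) ≤ (Fintype.card J : ℝ) := by
  choose f hf using fun S => hcover (splitGraph n hn S)
    (fun e he => splitGraph_eq_false_of_notMem_Estar hn S he) (fReach_splitGraph hn S)
  let M : Finset (Fin n) := {vone n hn, vlast n hn}ᶜ
  have hM : M.card = n - 2 := by
    rw [Finset.card_compl, Finset.card_pair (vone_ne_vlast n hn), Fintype.card_fin]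
  have hsub : ∀ S ∈ M.powerset, ∀ T, f S = f T → S ⊆ T := by
    intro S hS T hST v hv
    have hvM := Finset.mem_powerset.1 hS hv
    simp only [M, Finset.mem_compl, Finset.mem_insert, Finset.mem_singleton, not_or] at hvM
    exact mem_of_forces_of_extends hn (hforce (f S)) (hf S) (hST ▸ hf T) hvM.1 hvM.2 hv
  have hcard : M.powerset.card ≤ Fintype.card J :=
    Finset.card_le_card_of_injOn f (fun _ _ => Finset.mem_univ _) fun S hS T hT hST =>
      (hsub S hS T hST).antisymm (hsub T hT S hST.symm)
  rw [Finset.card_powerset, hM] at hcard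
  calc ((3 : ℝ) / 2) ^ (n - 2) ≤ 2 ^ (n - 2) := by gcongr; norm_num
    _ ≤ (Fintype.card J : ℝ) := by exact_mod_cast hcard
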